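/- arXiv:math/0506055 — 2 statements merged into one kernel-verified Lean document; each statement's English description precedes it below -/
import Mathlib

section
/- Let R be an associative algebra over a field of characteristic ≠ 2 with an involution *, let G be a finite abelian group, h ∈ G an element of order 2, and suppose R = ⊕_{g∈G} R̃_g is a G-grading with (R̃_g)* ⊆ R̃_g for all g. Define R_g = R̃_g^(−) ⊕ R̃_{gh}^(+), where B^(±) denotes the symmetric/skew-symmetric part of B under *. Then R = ⊕_{g∈G} R_g and [R_g, R_{g'}] ⊆ R_{gg'} for all g, g' ∈ G, i.e. this is a Lie grading of R. -/
/-- The symmetric part of a subspace `B` with respect to a linear involution `s`. -/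
def symPart {F R : Type*} [Field F] [Ring R] [Algebra F R]
    (s : R →ₗ[F] R) (B : Submodule F R) : Submodule F R :=
  B ⊓ LinearMap.ker (s - LinearMap.id)

/-- The skew-symmetric part of a subspace `B` with respect to a linear involution `s`. -/
def skewPart {F R : Type*} [Field F] [Ring R] [Algebra F R]
    (s : R →ₗ[F] R) (B : Submodule F R) : Submodule F R :=
  B ⊓ LinearMap.ker (s + LinearMap.id)

theorem coe_eq_sum_aux {F R : Type*} [Field F] [Ring R] [Algebra F R]
    {G : Type*} [Fintype G] [DecidableEq G] (A : G → Submodule F R)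
    (v : DirectSum G (fun g => A g)) :
    DirectSum.coeAddMonoidHom A v = ∑ g, (v g : R) := by
  induction v using DirectSum.induction_on with
  | zero => simp
  | of i x =>
    rw [DirectSum.coeAddMonoidHom_of, Finset.sum_eq_single i]
    · simp
    · intro b _ hb
      rw [DirectSum.of_eq_of_ne _ _ _ hb]
      rfl
    · simp
  | add x y hx hy => simp [hx, hy, Finset.sum_add_distrib]

theorem internal_zero_aux {F R : Type*} [Field F] [Ring R] [Algebra F R]
    {G : Type*} [Fintype G] [DecidableEq G] (A : G → Submodule F R)
    (hA : DirectSum.IsInternal A) (f : G → R) (hf : ∀ g, f g ∈ A g)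
    (h0 : ∑ g, f g = 0) (g : G) : f g = 0 := by
  let v : DirectSum G (fun g => A g) := DFinsupp.equivFunOnFintype.symm (fun g => ⟨f g, hf g⟩)
  have hv : v = 0 := by
    apply hA.injective
    rw [coe_eq_sum_aux, map_zero]
    exact h0
  have := congrArg (fun w : DirectSum G (fun g => A g) => (w g : R)) hv
  exact this

theorem mem_symPart_aux {F R : Type*} [Field F] [Ring R] [Algebra F R]
    (s : R →ₗ[F] R) (B : Submodule F R) (x : R) :
    x ∈ symPart s B ↔ x ∈ B ∧ s x = x := by
  simp [symPart, sub_eq_zero]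

theorem mem_skewPart_aux {F R : Type*} [Field F] [Ring R] [Algebra F R]
    (s : R →ₗ[F] R) (B : Submodule F R) (x : R) :
    x ∈ skewPart s B ↔ x ∈ B ∧ s x = -x := by
  simp [skewPart, add_eq_zero_iff_eq_neg]

/-- Given an involution `*` on an associative algebra `R` over a field of
characteristic ≠ 2, a finite abelian group `G`, an element `h` of order 2, and an
involution `G`-grading `R = ⊕ R̃_g`, the spaces `R_g = R̃_g⁽⁻⁾ ⊕ R̃_{gh}⁽⁺⁾` form a
Lie grading of `R`. -/
theorem lie_grading_from_involution_grading
    {F R : Type*} [Field F] (h2 : (2 : F) ≠ 0) [Ring R] [Algebra F R]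
    {G : Type*} [CommGroup G] [Fintype G] [DecidableEq G]
    (s : R →ₗ[F] R) (hanti : ∀ x y : R, s (x * y) = s y * s x) (hinv : ∀ x : R, s (s x) = x)
    (h : G) (hh1 : h ≠ 1) (hh2 : h * h = 1)
    (Rt : G → Submodule F R)
    (hdec : DirectSum.IsInternal Rt)
    (hmul : ∀ g g' : G, ∀ x ∈ Rt g, ∀ y ∈ Rt g', x * y ∈ Rt (g * g'))
    (hstar : ∀ g : G, ∀ x ∈ Rt g, s x ∈ Rt g) :
    DirectSum.IsInternal (fun g : G => skewPart s (Rt g) ⊔ symPart s (Rt (g * h))) ∧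
    ∀ g g' : G,
      ∀ x ∈ skewPart s (Rt g) ⊔ symPart s (Rt (g * h)),
      ∀ y ∈ skewPart s (Rt g') ⊔ symPart s (Rt (g' * h)),
        x * y - y * x ∈ skewPart s (Rt (g * g')) ⊔ symPart s (Rt (g * g' * h)) := by
  have half : ∀ x : R, x = -x → x = 0 := by
    intro x hx
    have : (2 : F) • x = 0 := by rw [two_smul]; nth_rewrite 1 [hx]; simp
    exact (smul_eq_zero.mp this).resolve_left h2
  have hgh : ∀ g : G, g * h * h = g := fun g => by rw [mul_assoc, hh2, mul_one]
  constructor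
  · constructor
    · rw [injective_iff_map_eq_zero]
      intro v hv
      rw [coe_eq_sum_aux] at hv
      have hx := fun g => Submodule.mem_sup.mp (v g).2
      choose a ha b hb hab using hx
      simp only [mem_skewPart_aux, mem_symPart_aux] at ha hb
      simp only [← hab, Finset.sum_add_distrib] at hv
      have hs := congrArg s hv
      simp only [map_add, map_sum, map_zero, fun g => (ha g).2, fun g => (hb g).2,
        Finset.sum_neg_distrib] at hs
      have e1 : ∑ g, b g = ∑ g, a g := by
        rw [neg_add_eq_zero] at hs; exact hs.symm
      have hA : ∑ g, a g = 0 := by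
        apply half
        rw [e1] at hv
        exact eq_neg_of_add_eq_zero_left hv
      have hB : ∑ g, b g = 0 := e1.trans hA
      have hA' := internal_zero_aux Rt hdec a (fun g => (ha g).1) hA
      have hB' := internal_zero_aux Rt hdec (fun g => b (g * h))
        (fun g => by have := (hb (g * h)).1; rwa [hgh] at this)
        (by rw [← hB]; exact Equiv.sum_comp (Equiv.mulRight h) b)
      refine DFinsupp.ext fun g => Subtype.ext ?_
      have hB'' := hB' (g * h)
      simp only [hgh] at hB''
      rw [← hab g, hA' g, hB'']
      simp
    · have htop : iSup (fun g : G => skewPart s (Rt g) ⊔ symPart s (Rt (g * h))) = ⊤ := by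
        rw [eq_top_iff, ← hdec.submodule_iSup_eq_top]
        refine iSup_le fun g x hx => ?_
        have hs := hstar g x hx
        have e : x = (2⁻¹ : F) • (x - s x) + (2⁻¹ : F) • (x + s x) := by
          rw [← smul_add]
          have : x - s x + (x + s x) = (2 : F) • x := by rw [two_smul]; abel
          rw [this, smul_smul, inv_mul_cancel₀ h2, one_smul]
        rw [e]
        refine add_mem (Submodule.smul_mem _ _ ?_) (Submodule.smul_mem _ _ ?_)
        · refine Submodule.mem_iSup_of_mem g (Submodule.mem_sup_left ?_)
          rw [mem_skewPart_aux]
          exact ⟨sub_mem hx hs, by rw [map_sub, hinv]; abel⟩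
        · refine Submodule.mem_iSup_of_mem (g * h) (Submodule.mem_sup_right ?_)
          rw [mem_symPart_aux, hgh]
          exact ⟨add_mem hx hs, by rw [map_add, hinv]; abel⟩
      have hr := Submodule.iSup_eq_range_dfinsupp_lsum
        (fun g : G => skewPart s (Rt g) ⊔ symPart s (Rt (g * h)))
      rw [htop] at hr
      exact LinearMap.range_eq_top.mp hr.symm
  · intro g g' x hx y hy
    obtain ⟨a, ha, b, hb, rfl⟩ := Submodule.mem_sup.mp hx
    obtain ⟨c, hc, d, hd, rfl⟩ := Submodule.mem_sup.mp hy
    rw [mem_skewPart_aux] at ha hc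
    rw [mem_symPart_aux] at hb hd
    have comm : ∀ k k' : G, ∀ x ∈ Rt k, ∀ y ∈ Rt k', x * y - y * x ∈ Rt (k * k') :=
      fun k k' x hx y hy => sub_mem (hmul k k' x hx y hy)
        (mul_comm k' k ▸ hmul k' k y hy x hx)
    refine Submodule.mem_sup.mpr ⟨(a * c - c * a) + (b * d - d * b), ?_,
      (a * d - d * a) + (b * c - c * b), ?_, by noncomm_ring⟩
    · rw [mem_skewPart_aux]
      refine ⟨add_mem (comm _ _ a ha.1 c hc.1) ?_, ?_⟩
      · have := comm _ _ b hb.1 d hd.1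
        rwa [mul_mul_mul_comm, hh2, mul_one] at this
      · simp only [map_add, map_sub, hanti, ha.2, hb.2, hc.2, hd.2]
        noncomm_ring
    · rw [mem_symPart_aux]
      refine ⟨add_mem ?_ ?_, ?_⟩
      · have := comm _ _ a ha.1 d hd.1
        rwa [← mul_assoc] at this
      · have := comm _ _ b hb.1 c hc.1
        rwa [mul_right_comm] at this
      · simp only [map_add, map_sub, hanti, ha.2, hb.2, hc.2, hd.2]
        noncomm_ring
end

section
/- Let F be an algebraically closed field of characteristic zero with a primitive n-th root of unity ε, and let R = M_n(F) carry the ε-grading by T = ⟨a⟩_n × ⟨b⟩_n (with R_{a^i b^j} = span(X_a^i X_b^j)). Suppose φ: R → R is given by φ(X) = −Φ^{−1} Xᵗ Φ for some invertible Φ, and φ(R_t) = R_t for all t ∈ T. Then n = 2, and Φ is (up to scalar) one of I, X_a, X_b, or X_a X_b. -/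
open Matrix

lemma two_case {F : Type*} [Field F] [CharZero F] (Φ : Matrix (Fin 2) (Fin 2) F)
    (hΦ : IsUnit Φ.det) (γ δ : F)
    (Xa Xb : Matrix (Fin 2) (Fin 2) F) (ha : Xa = !![-1, 0; 0, 1]) (hb : Xb = !![0, 1; 1, 0])
    (h1 : Xaᵀ * Φ = γ • (Φ * Xa)) (h2 : Xbᵀ * Φ = δ • (Φ * Xb)) :
      (∃ c : F, c ≠ 0 ∧ (Φ = c • 1 ∨ Φ = c • Xa ∨ Φ = c • Xb ∨ Φ = c • (Xa * Xb))) ∧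
      ∃ M : Matrix (Fin 2) (Fin 2) F,
        (M = 1 ∨ M = Xa ∨ M = Xb ∨ M = Xa * Xb) ∧
        ∀ X : Matrix (Fin 2) (Fin 2) F, X.trace = 0 →
          -(Φ⁻¹ * Xᵀ * Φ) = M⁻¹ * X * M := by
  have key : (∃ c : F, c ≠ 0 ∧ ((Φ = c • 1) ∨ Φ = c • Xa ∨ Φ = c • Xb ∨ Φ = c • (Xa * Xb))) := by
    have e00 := congrFun₂ h1 0 0
    have e01 := congrFun₂ h1 0 1
    have e10 := congrFun₂ h1 1 0
    have e11 := congrFun₂ h1 1 1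
    have f00 := congrFun₂ h2 0 0
    have f01 := congrFun₂ h2 0 1
    have f10 := congrFun₂ h2 1 0
    have f11 := congrFun₂ h2 1 1
    rw [isUnit_iff_ne_zero, det_fin_two] at hΦ
    simp [ha, hb, Matrix.mul_apply, Fin.sum_univ_two] at e00 e01 e10 e11 f00 f01 f10 f11
    have e2 : Φ = !![Φ 0 0, Φ 0 1; Φ 1 0, Φ 1 1] := eta_fin_two Φ
    generalize Φ 0 0 = p at *
    generalize Φ 0 1 = q at *
    generalize Φ 1 0 = r at *
    generalize Φ 1 1 = s at *
    subst e2
    by_cases hp : p = 0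
    · subst hp
      have hs : s = 0 := by simpa using f01
      subst hs
      have hq : q ≠ 0 := by rintro rfl; simp at hΦ
      have hd : (δ - 1) * (δ + 1) = 0 := by
        apply mul_left_cancel₀ hq; linear_combination -f11 - δ * f00
      rcases mul_eq_zero.1 hd with hd | hd
      · have : r = q := by linear_combination f00 + hd * q
        subst this
        exact ⟨r, hq, Or.inr (Or.inr (Or.inl (by simp [hb])))⟩
      · have : r = -q := by linear_combination f00 + hd * q
        subst this
        exact ⟨-q, by simpa using hq, Or.inr (Or.inr (Or.inr (by simp [ha, hb])))⟩
    · have hg : γ = 1 := by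
        apply mul_left_cancel₀ hp; linear_combination -e00
      subst hg
      have hq : q = 0 := by
        have : (2:F) * q = 0 := by linear_combination -e01
        simpa using this
      have hr : r = 0 := by
        have : (2:F) * r = 0 := by linear_combination e10
        simpa using this
      subst hq hr
      have hd : (δ - 1) * (δ + 1) = 0 := by
        apply mul_left_cancel₀ hp; linear_combination -f10 - δ * f01
      rcases mul_eq_zero.1 hd with hd | hd
      · have : s = p := by linear_combination f01 + hd * p
        subst this
        exact ⟨s, hp, Or.inl (by simp [Matrix.one_fin_two])⟩
      · have : s = -p := by linear_combination f01 + hd * p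
        subst this
        exact ⟨-p, by simpa using hp, Or.inr (Or.inl (by simp [ha]))⟩
  refine ⟨key, ?_⟩
  -- it suffices to verify a polynomial identity
  have main : ∀ M : Matrix (Fin 2) (Fin 2) F, IsUnit M.det →
      (∀ X : Matrix (Fin 2) (Fin 2) F, X.trace = 0 → -(Xᵀ * (Φ * M⁻¹)) = (Φ * M⁻¹) * X) →
      ∀ X : Matrix (Fin 2) (Fin 2) F, X.trace = 0 → -(Φ⁻¹ * Xᵀ * Φ) = M⁻¹ * X * M := by
    intro M hM h X hX
    have := h X hX
    calc -(Φ⁻¹ * Xᵀ * Φ) = Φ⁻¹ * (-(Xᵀ * (Φ * M⁻¹))) * M := by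
            simp only [Matrix.mul_neg, Matrix.neg_mul, Matrix.mul_assoc,
              Matrix.nonsing_inv_mul M hM, Matrix.mul_one]
      _ = M⁻¹ * X * M := by
            rw [this]
            simp only [← Matrix.mul_assoc, Matrix.nonsing_inv_mul Φ hΦ, Matrix.one_mul]
  have tr : ∀ X : Matrix (Fin 2) (Fin 2) F, X.trace = 0 → ∃ x y z, X = !![x, y; z, -x] := by
    intro X hX
    refine ⟨X 0 0, X 0 1, X 1 0, ?_⟩
    rw [trace_fin_two] at hX
    conv_lhs => rw [eta_fin_two X]
    rw [show X 1 1 = - X 0 0 by linear_combination hX]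
  obtain ⟨c, hc, h | h | h | h⟩ := key
  · refine ⟨Xa * Xb, by simp, main _ (by simp [ha, hb]) ?_⟩
    intro X hX
    obtain ⟨x, y, z, rfl⟩ := tr X hX
    subst h ha hb
    ext i j; fin_cases i <;> fin_cases j <;> simp [Matrix.inv_def, Matrix.mul_apply, Fin.sum_univ_two, adjugate_fin_two, mul_comm]
  · refine ⟨Xb, by simp, main _ (by simp [ha, hb]) ?_⟩
    intro X hX
    obtain ⟨x, y, z, rfl⟩ := tr X hX
    subst h ha hb
    ext i j; fin_cases i <;> fin_cases j <;> simp [Matrix.inv_def, Matrix.mul_apply, Fin.sum_univ_two, adjugate_fin_two, mul_comm]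
  · refine ⟨Xa, by simp, main _ (by simp [ha, hb]) ?_⟩
    intro X hX
    obtain ⟨x, y, z, rfl⟩ := tr X hX
    subst h ha hb
    ext i j; fin_cases i <;> fin_cases j <;> simp [Matrix.inv_def, Matrix.mul_apply, Fin.sum_univ_two, adjugate_fin_two, mul_comm]
  · refine ⟨1, by simp, main _ (by simp) ?_⟩
    intro X hX
    obtain ⟨x, y, z, rfl⟩ := tr X hX
    subst h ha hb
    ext i j; fin_cases i <;> fin_cases j <;> simp [Matrix.inv_def, Matrix.mul_apply, Fin.sum_univ_two, adjugate_fin_two, mul_comm]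

/-- Let `M_n(F)` (`F` algebraically closed of characteristic 0) carry the
`ε`-grading with components `span(X_a^i X_b^j)`. If `φ(X) = -Φ⁻¹ Xᵀ Φ` preserves every
homogeneous component, then `n = 2` and, up to scalar, `Φ` is one of `I, X_a, X_b, X_aX_b`;
moreover `φ` acts on traceless matrices as conjugation by one of `I, X_a, X_b, X_aX_b`. -/
theorem fine_grading_outer_forces_n_eq_two
    {F : Type*} [Field F] [IsAlgClosed F] [CharZero F] {n : ℕ} (hn : 1 < n)
    {ε : F} (hε : IsPrimitiveRoot ε n) :
    let Xa : Matrix (Fin n) (Fin n) F := Matrix.diagonal fun i => ε ^ (n - 1 - (i : ℕ))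
    let Xb : Matrix (Fin n) (Fin n) F :=
      Matrix.of fun i j => if j = i + ⟨1 % n, Nat.mod_lt 1 (Nat.lt_of_lt_of_le Nat.zero_lt_one hn.le)⟩ then 1 else 0
    ∀ Φ : Matrix (Fin n) (Fin n) F, IsUnit Φ.det →
      (∀ i j : ℕ, ∃ c : F, -(Φ⁻¹ * (Xa ^ i * Xb ^ j)ᵀ * Φ) = c • (Xa ^ i * Xb ^ j)) →
      n = 2 ∧
      (∃ c : F, c ≠ 0 ∧ (Φ = c • 1 ∨ Φ = c • Xa ∨ Φ = c • Xb ∨ Φ = c • (Xa * Xb))) ∧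
      ∃ M : Matrix (Fin n) (Fin n) F,
        (M = 1 ∨ M = Xa ∨ M = Xb ∨ M = Xa * Xb) ∧
        ∀ X : Matrix (Fin n) (Fin n) F, X.trace = 0 →
          -(Φ⁻¹ * Xᵀ * Φ) = M⁻¹ * X * M := by
  intro Xa Xb Φ hΦ h
  have hε0 : ε ≠ 0 := hε.ne_zero (by omega)
  have conv : ∀ Y : Matrix (Fin n) (Fin n) F, (∃ c : F, -(Φ⁻¹ * Yᵀ * Φ) = c • Y) →
      ∃ γ : F, Yᵀ * Φ = γ • (Φ * Y) := by
    rintro Y ⟨c, hc⟩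
    refine ⟨-c, ?_⟩
    calc Yᵀ * Φ = -(Φ * (-(Φ⁻¹ * Yᵀ * Φ))) := by
          simp only [Matrix.mul_neg, neg_neg, ← Matrix.mul_assoc, Matrix.mul_nonsing_inv Φ hΦ,
            Matrix.one_mul]
      _ = _ := by rw [hc]; simp
  obtain ⟨γ, h1⟩ := conv Xa (by simpa using h 1 0)
  obtain ⟨δ, h2⟩ := conv Xb (by simpa using h 0 1)
  have cancelR : ∀ Y : Matrix (Fin n) (Fin n) F, Y * Φ = 0 → Y = 0 := by
    intro Y hY
    have := congrArg (· * Φ⁻¹) hY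
    simpa [Matrix.mul_assoc, Matrix.mul_nonsing_inv Φ hΦ] using this
  have cancelL : ∀ Y : Matrix (Fin n) (Fin n) F, Φ * Y = 0 → Y = 0 := by
    intro Y hY
    have := congrArg (Φ⁻¹ * ·) hY
    simpa [← Matrix.mul_assoc, Matrix.nonsing_inv_mul Φ hΦ] using this
  have comm : Xa * Xb = ε • (Xb * Xa) := by
    ext i j
    simp only [Xa, Xb, Matrix.diagonal_mul, Matrix.smul_apply, Matrix.mul_diagonal, Matrix.of_apply,
      smul_eq_mul]
    split_ifs with hij
    · subst hij
      have hv : ((i + ⟨1 % n, Nat.mod_lt 1 (Nat.lt_of_lt_of_le Nat.zero_lt_one hn.le)⟩ : Fin n) : ℕ)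
        = (i + 1) % n := by simp [Fin.val_add]
      rw [hv]
      have hi := i.2
      rcases Nat.lt_or_ge (i + 1) n with hl | hl
      · rw [Nat.mod_eq_of_lt hl, one_mul, mul_one, ← pow_succ']
        congr 1; omega
      · have : (i : ℕ) + 1 = n := by omega
        rw [this, Nat.mod_self, one_mul, mul_one, ← pow_succ',
          show n - 1 - (i : ℕ) = 0 by omega, show n - 1 - 0 + 1 = n by omega, hε.pow_eq_one, pow_zero]
    · simp
  let z : Fin n := ⟨0, by omega⟩
  let o : Fin n := z + ⟨1 % n, Nat.mod_lt 1 (Nat.lt_of_lt_of_le Nat.zero_lt_one hn.le)⟩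
  have hXa : Xa ≠ 0 := by
    intro h0
    have := congrFun₂ h0 z z
    simp [Xa, hε0] at this
  have hXb : Xb ≠ 0 := by
    intro h0
    have := congrFun₂ h0 z o
    simp [Xb, o] at this
  have hXba : Xb * Xa ≠ 0 := by
    intro h0
    have := congrFun₂ h0 z o
    simp [Xa, Xb, o, Matrix.mul_diagonal, hε0] at this
  have hγ : γ ≠ 0 := by
    rintro rfl
    rw [zero_smul] at h1
    exact hXa (by simpa using cancelR _ h1)
  have hδ : δ ≠ 0 := by
    rintro rfl
    rw [zero_smul] at h2
    exact hXb (by simpa using cancelR _ h2)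
  have k1 : (Xa * Xb)ᵀ * Φ = (γ * δ) • (Φ * (Xb * Xa)) := by
    rw [Matrix.transpose_mul, Matrix.mul_assoc, h1, Matrix.mul_smul, ← Matrix.mul_assoc, h2,
      Matrix.smul_mul, smul_smul, Matrix.mul_assoc]
  have k2 : (Xb * Xa)ᵀ * Φ = (γ * δ) • (Φ * (Xa * Xb)) := by
    rw [Matrix.transpose_mul, Matrix.mul_assoc, h2, Matrix.mul_smul, ← Matrix.mul_assoc, h1,
      Matrix.smul_mul, smul_smul, Matrix.mul_assoc, mul_comm δ]
  have k3 : (γ * δ * (1 - ε ^ 2)) • (Φ * (Xb * Xa)) = 0 := by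
    rw [comm, Matrix.transpose_smul, Matrix.smul_mul, k2, comm, Matrix.mul_smul, smul_smul,
      smul_smul] at k1
    rw [mul_sub, sub_smul, mul_one, ← k1, ← sub_smul]
    rw [show ε * (γ * δ) * ε - γ * δ * ε ^ 2 = 0 by ring, zero_smul]
  have hsq : ε ^ 2 = 1 := by
    rcases smul_eq_zero.1 k3 with h0 | h0
    · have : 1 - ε ^ 2 = 0 := by simpa [hγ, hδ] using h0
      linear_combination -this
    · exact absurd (cancelL _ h0) hXba
  have hn2 : n = 2 := by
    have := Nat.le_of_dvd (by norm_num) (hε.dvd_of_pow_eq_one 2 hsq)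
    omega
  refine ⟨hn2, ?_⟩
  subst hn2
  have he : ε = -1 := hε.eq_neg_one_of_two_right
  refine two_case Φ hΦ γ δ Xa Xb ?_ ?_ h1 h2
  · ext i j; fin_cases i <;> fin_cases j <;> simp [Xa, he]
  · ext i j; fin_cases i <;> fin_cases j <;> simp [Xb]
end
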